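/- arXiv:2512.17700 — 6 statements merged into one kernel-verified Lean document; each statement's English description precedes it below -/
import Mathlib

section
/- (Existence part of Jones' theorem.) Let M be a symmetric n×n real matrix. Then there exists a chain of subsets ∅ = S₀ ⊊ S₁ ⊊ ⋯ ⊊ Sₙ = {1,…,n} of the index set with |Sᵢ| = i for each i, such that for every index i with i < rank(M), the determinants det(M[Sᵢ]) and det(M[Sᵢ₊₁]) are not both zero. -/
open Matrix

/-- The principal minor of M indexed by a subset S of the index set
(the determinant of the empty matrix is 1). -/
noncomputable def principalMinor {n : ℕ} (M : Matrix (Fin n) (Fin n) ℝ)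
    (S : Finset (Fin n)) : ℝ :=
  (M.submatrix (fun i : {x // x ∈ S} => (i : Fin n)) (fun j : {x // x ∈ S} => (j : Fin n))).det

/-- The Schur complement of `M[S]` in `M`, extended by the same formula to all of the index set. -/
noncomputable def schurComplement {n : ℕ} (M : Matrix (Fin n) (Fin n) ℝ) (S : Finset (Fin n)) :
    Matrix (Fin n) (Fin n) ℝ :=
  M - M.submatrix id (Subtype.val : {x // x ∈ S} → Fin n) *
    (M.submatrix (Subtype.val : {x // x ∈ S} → Fin n)
      (Subtype.val : {x // x ∈ S} → Fin n))⁻¹ *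
      M.submatrix (Subtype.val : {x // x ∈ S} → Fin n) id

theorem schurComplement_isSymm {n : ℕ} {M : Matrix (Fin n) (Fin n) ℝ} (hM : M.IsSymm)
    (S : Finset (Fin n)) : (schurComplement M S).IsSymm := by
  have h : Mᵀ = M := hM
  simp [schurComplement, Matrix.IsSymm, transpose_mul, transpose_submatrix, h,
    transpose_nonsing_inv, Matrix.mul_assoc]

theorem det_submatrix_sumElim {n : ℕ} {κ : Type*} [Fintype κ] [DecidableEq κ]
    (M : Matrix (Fin n) (Fin n) ℝ) {S : Finset (Fin n)} (hS : principalMinor M S ≠ 0)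
    (f : κ → Fin n) :
    (M.submatrix (Sum.elim (Subtype.val : {x // x ∈ S} → Fin n) f)
      (Sum.elim (Subtype.val : {x // x ∈ S} → Fin n) f)).det =
      principalMinor M S * ((schurComplement M S).submatrix f f).det := by
  have hA : IsUnit (M.submatrix (Subtype.val : {x // x ∈ S} → Fin n)
      (Subtype.val : {x // x ∈ S} → Fin n)).det :=
    isUnit_iff_ne_zero.2 hS
  let _ := invertibleOfIsUnitDet _ hA
  have hblocks : M.submatrix (Sum.elim (Subtype.val : {x // x ∈ S} → Fin n) f)
      (Sum.elim (Subtype.val : {x // x ∈ S} → Fin n) f) =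
      fromBlocks
        (M.submatrix (Subtype.val : {x // x ∈ S} → Fin n) (Subtype.val : {x // x ∈ S} → Fin n))
        (M.submatrix (Subtype.val : {x // x ∈ S} → Fin n) f)
        (M.submatrix f (Subtype.val : {x // x ∈ S} → Fin n)) (M.submatrix f f) := by
    ext (i | i) (j | j) <;> rfl
  rw [hblocks, det_fromBlocks₁₁, invOf_eq_nonsing_inv]
  rfl

theorem injective_of_det_submatrix_ne_zero {n : ℕ} {κ : Type*} [Fintype κ] [DecidableEq κ]
    {M : Matrix (Fin n) (Fin n) ℝ} {g : κ → Fin n} (h : (M.submatrix g g).det ≠ 0) :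
    Function.Injective g := by
  intro a b hab
  by_contra hne
  exact h (det_zero_of_row_eq hne (by ext j; simp [hab]))

theorem principalMinor_image_ne_zero {n : ℕ} {κ : Type*} [Fintype κ] [DecidableEq κ]
    {M : Matrix (Fin n) (Fin n) ℝ} {g : κ → Fin n} (h : (M.submatrix g g).det ≠ 0) :
    principalMinor M (Finset.univ.image g) ≠ 0 := by
  have hg := injective_of_det_submatrix_ne_zero h
  let e : κ ≃ {x // x ∈ Finset.univ.image g} :=
    Equiv.ofBijective (fun a => ⟨g a, by simp⟩)
      ⟨fun a b hab => hg (congrArg Subtype.val hab), fun ⟨x, hx⟩ => by simpa using hx⟩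
  rw [principalMinor, ← det_submatrix_equiv_self e]
  exact h

theorem rank_le_card_of_schurComplement_eq_zero {n : ℕ} {M : Matrix (Fin n) (Fin n) ℝ}
    {S : Finset (Fin n)} (h : schurComplement M S = 0) : M.rank ≤ S.card := by
  rw [sub_eq_zero.1 h, Matrix.mul_assoc]
  refine (rank_mul_le_left _ _).trans ((rank_le_card_width _).trans ?_)
  simp

/-- A nonsingular principal submatrix of a symmetric matrix, of order less than the rank, can be
enlarged by one or two indices to another nonsingular one. -/
theorem exists_principalMinor_insert_ne_zero {n : ℕ} {M : Matrix (Fin n) (Fin n) ℝ}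
    (hM : M.IsSymm) {S : Finset (Fin n)} (hS : principalMinor M S ≠ 0) (hr : S.card < M.rank) :
    (∃ i ∉ S, principalMinor M (insert i S) ≠ 0) ∨
      ∃ i ∉ S, ∃ j ∉ insert i S, principalMinor M (insert j (insert i S)) ≠ 0 := by
  have one (i : Fin n) (hi : schurComplement M S i i ≠ 0) :
      ∃ i ∉ S, principalMinor M (insert i S) ≠ 0 := by
    have hdet : (M.submatrix (Sum.elim (Subtype.val : {x // x ∈ S} → Fin n) fun _ : Unit => i)
        (Sum.elim (Subtype.val : {x // x ∈ S} → Fin n) fun _ => i)).det ≠ 0 := by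
      rw [det_submatrix_sumElim M hS]
      exact mul_ne_zero hS (by simpa using hi)
    have hinj := injective_of_det_submatrix_ne_zero hdet
    refine ⟨i, fun hiS => ?_, ?_⟩
    · simpa using @hinj (Sum.inl ⟨i, hiS⟩) (Sum.inr ()) rfl
    · convert principalMinor_image_ne_zero hdet using 2
      ext x
      simp [or_comm, eq_comm]
  obtain ⟨i, j, hij⟩ : ∃ i j, schurComplement M S i j ≠ 0 := by
    by_contra! h
    exact hr.not_ge (rank_le_card_of_schurComplement_eq_zero (Matrix.ext h))
  by_cases hi : schurComplement M S i i = 0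
  swap
  · exact Or.inl (one i hi)
  have hdet : (M.submatrix (Sum.elim (Subtype.val : {x // x ∈ S} → Fin n) ![i, j])
      (Sum.elim (Subtype.val : {x // x ∈ S} → Fin n) ![i, j])).det ≠ 0 := by
    rw [det_submatrix_sumElim M hS]
    refine mul_ne_zero hS ?_
    rw [det_fin_two]
    simpa [hi, (schurComplement_isSymm hM S).apply i j] using hij
  have hinj := injective_of_det_submatrix_ne_zero hdet
  refine Or.inr ⟨i, fun hiS => ?_, j, fun hj => ?_, ?_⟩
  · simpa using @hinj (Sum.inl ⟨i, hiS⟩) (Sum.inr 0) rfl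
  · obtain rfl | hjS := Finset.mem_insert.1 hj
    · simpa using @hinj (Sum.inr 0) (Sum.inr 1) rfl
    · simpa using @hinj (Sum.inl ⟨j, hjS⟩) (Sum.inr 1) rfl
  · convert principalMinor_image_ne_zero hdet using 2
    ext x
    simp [or_comm, or_assoc, or_left_comm, eq_comm]

/-- The sets from which a chain with no two consecutive vanishing principal minors below the rank
can be continued. -/
def IsExtendable {n : ℕ} (M : Matrix (Fin n) (Fin n) ℝ) (S : Finset (Fin n)) : Prop :=
  M.rank ≤ S.card ∨ principalMinor M S ≠ 0 ∨ ∃ i ∉ S, principalMinor M (insert i S) ≠ 0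

theorem IsExtendable.exists_insert {n : ℕ} {M : Matrix (Fin n) (Fin n) ℝ} (hM : M.IsSymm)
    {S : Finset (Fin n)} (hS : IsExtendable M S) (hn : S.card < n) :
    ∃ i ∉ S, IsExtendable M (insert i S) ∧
      (S.card < M.rank → ¬(principalMinor M S = 0 ∧ principalMinor M (insert i S) = 0)) := by
  rcases le_or_gt M.rank S.card with hr | hr
  · obtain ⟨i, -, hi⟩ := Finset.exists_mem_notMem_of_card_lt_card
      (s := S) (t := Finset.univ) (by simpa using hn)
    exact ⟨i, hi, Or.inl (hr.trans (Finset.card_le_card (Finset.subset_insert i S))),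
      fun h => absurd h hr.not_gt⟩
  · rcases hS with h | h | ⟨i, hi, h⟩
    · exact absurd h hr.not_ge
    · rcases exists_principalMinor_insert_ne_zero hM h hr with ⟨i, hi, h'⟩ | ⟨i, hi, h'⟩
      · exact ⟨i, hi, Or.inr (Or.inl h'), fun _ h'' => h h''.1⟩
      · exact ⟨i, hi, Or.inr (Or.inr h'), fun _ h'' => h h''.1⟩
    · exact ⟨i, hi, Or.inr (Or.inl h), fun _ h' => h h'.2⟩

/-- existence part of Jones' theorem: for a symmetric n×n real matrix M
there is a chain ∅ = S₀ ⊊ S₁ ⊊ ⋯ ⊊ Sₙ = {1,…,n} with |Sᵢ| = i such that for every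
i < rank M the principal minors det(M[Sᵢ]) and det(M[Sᵢ₊₁]) are not both zero. -/
theorem exists_sigma_series {n : ℕ} (M : Matrix (Fin n) (Fin n) ℝ) (hM : M.IsSymm) :
    ∃ S : Fin (n + 1) → Finset (Fin n),
      S 0 = ∅ ∧
      S (Fin.last n) = Finset.univ ∧
      (∀ i : Fin (n + 1), (S i).card = i) ∧
      (∀ i j : Fin (n + 1), i < j → S i ⊂ S j) ∧
      (∀ i : Fin n, (i : ℕ) < M.rank →
        ¬(principalMinor M (S i.castSucc) = 0 ∧ principalMinor M (S i.succ) = 0)) := by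
  have step (S : {S // IsExtendable M S}) : ∃ T : {S // IsExtendable M S}, S.1 ⊆ T.1 ∧
      (S.1.card < n → T.1.card = S.1.card + 1 ∧ (S.1.card < M.rank →
        ¬(principalMinor M S.1 = 0 ∧ principalMinor M T.1 = 0))) := by
    by_cases hn : S.1.card < n
    · obtain ⟨i, hi, hext, h⟩ := S.2.exists_insert hM hn
      exact ⟨⟨_, hext⟩, Finset.subset_insert i S.1, fun _ => ⟨Finset.card_insert_of_notMem hi, h⟩⟩
    · exact ⟨S, subset_rfl, fun h => absurd h hn⟩
  choose next hsub hnext using step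
  have hempty : IsExtendable M ∅ := Or.inr (Or.inl (by simp [principalMinor]))
  let C : ℕ → {S // IsExtendable M S} := fun k => next^[k] ⟨∅, hempty⟩
  have hC (k : ℕ) : C (k + 1) = next (C k) := Function.iterate_succ_apply' _ _ _
  have hmono : Monotone fun k => (C k).1 :=
    monotone_nat_of_le_succ fun k => by simpa only [hC] using hsub (C k)
  have hcard (k : ℕ) (hk : k ≤ n) : (C k).1.card = k := by
    induction k with
    | zero => rfl
    | succ k ih =>
      have hk' := ih (by omega)
      rw [hC, (hnext (C k) (by omega)).1, hk']
  refine ⟨fun i => (C i).1, rfl, ?_, fun i => hcard i (by omega), fun i j hij => ?_,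
    fun i hi => ?_⟩
  · exact (Finset.card_eq_iff_eq_univ _).1 (by simpa using hcard n le_rfl)
  · refine Finset.ssubset_iff_subset_ne.2 ⟨hmono (by exact_mod_cast hij.le), fun h => ?_⟩
    have := congrArg Finset.card h
    rw [hcard i (by omega), hcard j (by omega)] at this
    omega
  · have hi' := hcard i (by omega)
    have h := (hnext (C i) (by omega)).2 (by omega)
    rwa [← hC] at h
end

section
/- Let N be a nonsingular symmetric (n+1)×(n+1) real matrix whose leading principal n×n submatrix M (obtained by deleting the last row and column of N) is also nonsingular. Then σ(N) = σ(M) + sign(det(M) · det(N)). In particular |σ(N) − σ(M)| = 1. -/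
open Matrix

/-- The sign of a real number, as an integer. -/
noncomputable def sgn (x : ℝ) : ℤ :=
  if 0 < x then 1 else if x < 0 then -1 else 0

/-- The signature of a real symmetric (Hermitian) matrix: the number of positive
eigenvalues minus the number of negative eigenvalues, counted with multiplicity
(junk value 0 if the matrix is not Hermitian). -/
noncomputable def signature {m : Type*} [Fintype m] [DecidableEq m]
    (M : Matrix m m ℝ) : ℤ :=
  if hM : M.IsHermitian then
    ((Finset.univ.filter fun i => 0 < hM.eigenvalues i).card : ℤ) -
      ((Finset.univ.filter fun i => hM.eigenvalues i < 0).card : ℤ)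
  else 0

/-- A matrix congruent to a diagonal matrix defines a quadratic form equivalent to the
corresponding weighted sum of squares. -/
theorem toQuadraticForm'_equivalent_weightedSumSquares {m ι : Type*} [Fintype m] [DecidableEq m]
    [Fintype ι] [DecidableEq ι] {A : Matrix m m ℝ} {P : Matrix m ι ℝ} {Q : Matrix ι m ℝ}
    {w : ι → ℝ} (hPQ : P * Q = 1) (hQP : Q * P = 1) (hA : A = P * diagonal w * Pᵀ) :
    A.toQuadraticForm'.Equivalent (QuadraticMap.weightedSumSquares ℝ w) := by
  refine ⟨⟨toLin'OfInv (M := Qᵀ) (M' := Pᵀ) ?_ ?_, fun x => ?_⟩⟩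
  · rw [← transpose_mul, hPQ, transpose_one]
  · rw [← transpose_mul, hQP, transpose_one]
  · change QuadraticMap.weightedSumSquares ℝ w (Pᵀ *ᵥ x) = A.toQuadraticForm' x
    rw [toQuadraticForm', LinearMap.BilinMap.toQuadraticMap_apply, toLinearMap₂'_apply', hA,
      ← mulVec_mulVec, ← mulVec_mulVec, dotProduct_mulVec, ← mulVec_transpose]
    simp only [QuadraticMap.weightedSumSquares_apply, dotProduct, mulVec_diagonal, smul_eq_mul]
    exact Finset.sum_congr rfl fun i _ => by ring

/-- The spectral theorem for real symmetric matrices, stated with transposes. -/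
theorem exists_orthogonal_eq_mul_diagonal_eigenvalues {m : Type*} [Fintype m] [DecidableEq m]
    {A : Matrix m m ℝ} (hA : A.IsHermitian) :
    ∃ U : Matrix m m ℝ, U * Uᵀ = 1 ∧ Uᵀ * U = 1 ∧ A = U * diagonal hA.eigenvalues * Uᵀ := by
  refine ⟨hA.eigenvectorUnitary, ?_, ?_, ?_⟩
  all_goals rw [← conjTranspose_eq_transpose_of_trivial, ← star_eq_conjTranspose]
  · exact Unitary.coe_mul_star_self _
  · exact Unitary.coe_star_mul_self _
  · conv_lhs => rw [hA.spectral_theorem, Unitary.conjStarAlgAut_apply]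
    rfl

theorem sum_sgn_eq_ncard_sub_ncard {ι : Type*} [Fintype ι] (w : ι → ℝ) :
    ∑ i, sgn (w i) = ({i | 0 < w i}.ncard : ℤ) - ({i | w i < 0}.ncard : ℤ) := by
  classical
  have h (i) : sgn (w i) = (if 0 < w i then 1 else 0) - (if w i < 0 then 1 else 0) := by
    unfold sgn
    split_ifs <;> first | rfl | linarith
  simp [h, Finset.sum_sub_distrib, Set.ncard_eq_toFinset_card']

/-- **Sylvester's law of inertia**, in terms of eigenvalues: the signature of a matrix congruent to a
diagonal matrix is the sum of the signs of the diagonal entries. -/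
theorem signature_eq_sum_sgn_of_congr {m ι : Type*} [Fintype m] [DecidableEq m]
    [Fintype ι] [DecidableEq ι] {A : Matrix m m ℝ} {P : Matrix m ι ℝ} {Q : Matrix ι m ℝ}
    {w : ι → ℝ} (hPQ : P * Q = 1) (hQP : Q * P = 1) (hA : A = P * diagonal w * Pᵀ) :
    signature A = ∑ i, sgn (w i) := by
  have hH : A.IsHermitian := by
    simp [IsHermitian, conjTranspose_eq_transpose_of_trivial, hA, Matrix.mul_assoc]
  obtain ⟨U, hU, hU', hAU⟩ := exists_orthogonal_eq_mul_diagonal_eigenvalues hH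
  have hw := toQuadraticForm'_equivalent_weightedSumSquares hPQ hQP hA
  have hv := toQuadraticForm'_equivalent_weightedSumSquares hU hU' hAU
  rw [sum_sgn_eq_ncard_sub_ncard, ← QuadraticForm.sigPos_of_equiv_weightedSumSquares hw,
    ← QuadraticForm.sigNeg_of_equiv_weightedSumSquares hw,
    QuadraticForm.sigPos_of_equiv_weightedSumSquares hv,
    QuadraticForm.sigNeg_of_equiv_weightedSumSquares hv, signature, dif_pos hH]
  simp [Set.ncard_eq_toFinset_card']

theorem sgn_mul_of_pos {a : ℝ} (ha : 0 < a) (x : ℝ) : sgn (a * x) = sgn x := by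
  simp [sgn, ha, mul_neg_iff, ha.not_gt]

theorem abs_sgn_of_ne_zero {x : ℝ} (hx : x ≠ 0) : |sgn x| = 1 := by
  rcases hx.lt_or_gt with h | h <;> simp [sgn, h, h.not_gt]

/-- if N is a nonsingular symmetric (n+1)×(n+1) real matrix whose leading
principal n×n submatrix M is also nonsingular, then
σ(N) = σ(M) + sign(det M · det N), and in particular |σ(N) − σ(M)| = 1. -/
theorem signature_succ_of_nonsingular_leading {n : ℕ}
    (N : Matrix (Fin (n + 1)) (Fin (n + 1)) ℝ) (hN : N.IsSymm) (hNdet : N.det ≠ 0)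
    (M : Matrix (Fin n) (Fin n) ℝ)
    (hM : M = N.submatrix Fin.castSucc Fin.castSucc) (hMdet : M.det ≠ 0) :
    signature N = signature M + sgn (M.det * N.det) ∧
      |signature N - signature M| = 1 := by
  have hMs : M.IsSymm := by rw [hM]; exact hN.submatrix _
  let e : Fin n ⊕ Fin 1 ≃ Fin (n + 1) := finSumFinEquiv
  let B : Matrix (Fin n) (Fin 1) ℝ := (N.submatrix e e).toBlocks₁₂
  let D : Matrix (Fin 1) (Fin 1) ℝ := (N.submatrix e e).toBlocks₂₂
  have hblocks : N.submatrix e e = fromBlocks M B Bᵀ D := by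
    rw [← fromBlocks_toBlocks (N.submatrix e e)]
    congr 1
    · rw [hM]; rfl
    · ext i j
      exact hN.apply _ _
  have hMdet' : IsUnit M.det := hMdet.isUnit
  let _ : Invertible M := invertibleOfIsUnitDet M hMdet'
  let s : ℝ := (D - Bᵀ * M⁻¹ * B) 0 0
  have hs : D - Bᵀ * M⁻¹ * B = diagonal fun _ => s := by
    ext i j
    fin_cases i; fin_cases j
    simp [s]
  have hdet : N.det = M.det * s := by
    rw [← det_submatrix_equiv_self e, hblocks, det_fromBlocks₁₁, invOf_eq_nonsing_inv, hs, det_diagonal]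
    simp
  have hMH : M.IsHermitian := by rwa [IsHermitian, conjTranspose_eq_transpose_of_trivial]
  obtain ⟨U, hU, hU', hw⟩ := exists_orthogonal_eq_mul_diagonal_eigenvalues hMH
  set w := hMH.eigenvalues
  have hinv : M⁻¹ᵀ = M⁻¹ := by rw [transpose_nonsing_inv, hMs]
  let L : Matrix (Fin n ⊕ Fin 1) (Fin n ⊕ Fin 1) ℝ := fromBlocks U 0 (Bᵀ * M⁻¹ * U) 1
  let L' : Matrix (Fin n ⊕ Fin 1) (Fin n ⊕ Fin 1) ℝ := fromBlocks Uᵀ 0 (-(Bᵀ * M⁻¹)) 1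
  have hLL' : L * L' = 1 := by
    simp [L, L', fromBlocks_multiply, hU, Matrix.mul_assoc]
  have hL'L : L' * L = 1 := mul_eq_one_comm.mp hLL'
  have hNL : N.submatrix e e = L * diagonal (Sum.elim w fun _ => s) * Lᵀ := by
    have hD : D = Bᵀ * M⁻¹ * B + diagonal fun _ => s := by rw [← hs]; abel
    have h₁ : U * (diagonal w * Uᵀ) = M := by rw [← Matrix.mul_assoc, ← hw]
    have h₂ (X : Matrix (Fin n) (Fin 1) ℝ) : U * (diagonal w * (Uᵀ * X)) = M * X := by
      rw [← h₁]; simp only [Matrix.mul_assoc]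
    rw [hblocks, ← fromBlocks_diagonal]
    simp [-fromBlocks_diagonal, L, fromBlocks_multiply, fromBlocks_transpose, transpose_mul, hinv, Matrix.mul_assoc,
      h₁, h₂, hD]
  have hsN : signature N = ∑ i : Fin n ⊕ Fin 1, sgn (Sum.elim w (fun _ => s) i) := by
    refine signature_eq_sum_sgn_of_congr (P := L.submatrix e.symm id) (Q := L'.submatrix id e.symm)
      ?_ ?_ ?_
    · rw [← submatrix_mul _ _ _ _ _ Function.bijective_id, hLL', submatrix_one_equiv]
    · rw [submatrix_mul_equiv, hL'L, submatrix_one _ Function.injective_id]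
    · have h := congrArg (fun X => X.submatrix e.symm e.symm) hNL
      simpa [← submatrix_mul_equiv _ _ _ (Equiv.refl _)] using h
  have hsM : signature M = ∑ i, sgn (w i) := signature_eq_sum_sgn_of_congr hU hU' hw
  have hsgn : sgn (M.det * N.det) = sgn s := by
    rw [hdet, ← mul_assoc, sgn_mul_of_pos (mul_self_pos.mpr hMdet)]
  have hmain : signature N = signature M + sgn (M.det * N.det) := by
    rw [hsN, hsM, hsgn]
    simp
  refine ⟨hmain, ?_⟩
  rw [hmain, add_sub_cancel_left]
  exact abs_sgn_of_ne_zero (mul_ne_zero hMdet hNdet)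
end

section
/- Let n ≥ 1 and let M and M' be nonsingular symmetric n×n real matrices that coincide in all entries except possibly the (n,n) diagonal entry, and let P denote their common leading principal (n−1)×(n−1) submatrix. Then σ(M) − σ(M') = sign(det(P)) · (sign(det(M)) − sign(det(M'))). In particular, σ(M) − σ(M') ∈ {−2, 0, 2}. -/
open Matrix

theorem toQuadraticForm'_apply_eq_dotProduct {m : Type*} [Fintype m] [DecidableEq m]
    (M : Matrix m m ℝ) (x : m → ℝ) : M.toQuadraticForm' x = x ⬝ᵥ M *ᵥ x := by
  simp [Matrix.toQuadraticForm', Matrix.toLinearMap₂'_apply']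

theorem equivalent_weightedSumSquares_eigenvalues {m : Type*} [Fintype m] [DecidableEq m]
    {M : Matrix m m ℝ} (hM : M.IsHermitian) :
    QuadraticMap.Equivalent M.toQuadraticForm'
      (QuadraticMap.weightedSumSquares ℝ hM.eigenvalues) := by
  let U := hM.eigenvectorUnitary
  refine QuadraticMap.Equivalent.symm ⟨⟨Matrix.UnitaryGroup.toLinearEquiv U, fun x => ?_⟩⟩
  have hx : Matrix.UnitaryGroup.toLinearEquiv U x = (U : Matrix m m ℝ) *ᵥ x := rfl
  have h : (U : Matrix m m ℝ)ᵀ * M * (U : Matrix m m ℝ) = diagonal hM.eigenvalues := by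
    have := hM.conjStarAlgAut_star_eigenvectorUnitary
    simpa [Unitary.conjStarAlgAut_apply, star_eq_conjTranspose, U, Function.comp_def] using this
  change M.toQuadraticForm' (Matrix.UnitaryGroup.toLinearEquiv U x) = _
  rw [hx, toQuadraticForm'_apply_eq_dotProduct, Matrix.mulVec_mulVec,
    ← Matrix.vecMul_transpose, ← Matrix.dotProduct_mulVec, Matrix.mulVec_mulVec,
    ← Matrix.mul_assoc, h,
    QuadraticMap.weightedSumSquares_apply]
  simp only [dotProduct, mulVec_diagonal, smul_eq_mul]
  exact Finset.sum_congr rfl fun i _ => by ring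

theorem signature_eq_and_sgn_det_eq {m : Type*} [Fintype m] [DecidableEq m]
    {M : Matrix m m ℝ} (hM : M.IsHermitian) (hdet : M.det ≠ 0) :
    signature M = 2 * (sigPos M.toQuadraticForm' : ℤ) - Fintype.card m ∧
      sgn M.det = (-1) ^ (sigPos M.toQuadraticForm' + Fintype.card m) := by
  have hprod : M.det = ∏ i, hM.eigenvalues i := by simpa using hM.det_eq_prod_eigenvalues
  have hne : ∀ i, hM.eigenvalues i ≠ 0 := fun i hi =>
    hdet (hprod ▸ Finset.prod_eq_zero (Finset.mem_univ i) hi)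
  have hpos : sigPos M.toQuadraticForm' =
      (Finset.univ.filter fun i => 0 < hM.eigenvalues i).card := by
    rw [QuadraticForm.sigPos_of_equiv_weightedSumSquares
      (equivalent_weightedSumSquares_eigenvalues hM), Set.ncard_eq_toFinset_card']
    simp
  have hnot : (Finset.univ.filter fun i => ¬ 0 < hM.eigenvalues i) =
      Finset.univ.filter fun i => hM.eigenvalues i < 0 :=
    Finset.filter_congr fun i _ => by simpa using (hne i).le_iff_lt
  have hcard := Finset.card_filter_add_card_filter_not (s := Finset.univ)
    fun i => 0 < hM.eigenvalues i
  rw [hnot, Finset.card_univ] at hcard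
  rw [hpos, ← hcard]
  constructor
  · rw [signature, dif_pos hM]
    push_cast
    ring
  · have hsgn : 0 < (-1 : ℝ) ^ (Finset.univ.filter fun i => hM.eigenvalues i < 0).card * M.det := by
      rw [hprod, ← Finset.prod_filter_mul_prod_filter_not _ (fun i => 0 < hM.eigenvalues i), hnot,
        mul_left_comm, ← Finset.prod_const, ← Finset.prod_mul_distrib]
      refine mul_pos (Finset.prod_pos fun i hi => (Finset.mem_filter.1 hi).2)
        (Finset.prod_pos fun i hi => ?_)
      have := (Finset.mem_filter.1 hi).2
      linarith
    rw [← add_assoc, ← two_mul, pow_add, pow_mul]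
    rcases neg_one_pow_eq_or ℝ (Finset.univ.filter fun i => hM.eigenvalues i < 0).card with h | h
    · have h' : (-1 : ℤ) ^ (Finset.univ.filter fun i => hM.eigenvalues i < 0).card = 1 := by
        exact_mod_cast h
      rw [h, one_mul] at hsgn
      simp [sgn, h', hsgn]
    · have h' : (-1 : ℤ) ^ (Finset.univ.filter fun i => hM.eigenvalues i < 0).card = -1 := by
        exact_mod_cast h
      rw [h] at hsgn
      have : M.det < 0 := by linarith
      simp [sgn, h', this, this.not_gt]

theorem sigPos_mono {V : Type*} [AddCommGroup V] [Module ℝ V] [Module.Finite ℝ V]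
    {Q Q' : QuadraticForm ℝ V} (h : ∀ x, Q' x ≤ Q x) : sigPos Q' ≤ sigPos Q := by
  obtain ⟨W, hW, hWpos⟩ := exists_finrank_eq_sigPos_and_posDef Q'
  rw [← hW]
  exact le_sigPos_of_posDef Q fun x hx => (hWpos x hx).trans_le (h x)

theorem sigPos_le_sigPos_add_one {V : Type*} [AddCommGroup V] [Module ℝ V] [Module.Finite ℝ V]
    {Q Q' : QuadraticForm ℝ V} (f : V →ₗ[ℝ] ℝ) (h : ∀ x, f x = 0 → Q x = Q' x) :
    sigPos Q ≤ sigPos Q' + 1 := by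
  obtain ⟨W, hW, hWpos⟩ := exists_finrank_eq_sigPos_and_posDef Q
  have hle : Module.finrank ℝ ↥(W ⊓ LinearMap.ker f) ≤ sigPos Q' :=
    le_sigPos_of_posDef Q' fun x hx => by
      have := hWpos ⟨x, x.2.1⟩ fun h0 => hx (by simpa using h0)
      simpa [← h x x.2.2] using this
  have h1 := Submodule.finrank_add_le_finrank_add_finrank W (LinearMap.ker f)
  have h2 := Submodule.finrank_sup_add_finrank_inf_eq W (LinearMap.ker f)
  have h3 := Submodule.finrank_le (W ⊔ LinearMap.ker f)
  have h4 := f.finrank_range_add_finrank_ker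
  have h5 := Submodule.finrank_le (LinearMap.range f)
  rw [Module.finrank_self] at h5
  omega

theorem det_sub_det_of_eq_except_last {R : Type*} [CommRing R] {n : ℕ}
    {M M' : Matrix (Fin (n + 1)) (Fin (n + 1)) R}
    (h : ∀ i j : Fin (n + 1), ¬(i = Fin.last n ∧ j = Fin.last n) → M i j = M' i j) :
    M.det - M'.det = (M (Fin.last n) (Fin.last n) - M' (Fin.last n) (Fin.last n)) *
      (M.submatrix Fin.castSucc Fin.castSucc).det := by
  have hminor (j : Fin (n + 1)) : M.submatrix (Fin.last n).succAbove j.succAbove =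
      M'.submatrix (Fin.last n).succAbove j.succAbove := by
    ext a b
    exact h _ _ fun hab => Fin.succAbove_ne _ _ hab.1
  rw [det_succ_row M (Fin.last n), det_succ_row M' (Fin.last n), Fin.sum_univ_castSucc,
    Fin.sum_univ_castSucc]
  simp only [hminor]
  rw [Finset.sum_congr rfl fun j _ => by
    rw [h (Fin.last n) (Fin.castSucc j) fun hj => (Fin.castSucc_lt_last j).ne hj.2]]
  have hP : M.submatrix Fin.castSucc Fin.castSucc = M'.submatrix Fin.castSucc Fin.castSucc := by
    simpa using hminor (Fin.last n)
  simp only [Fin.succAbove_last, hP, Fin.val_last, ← two_mul, pow_mul, neg_one_sq, one_pow]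
  ring

theorem toQuadraticForm'_sub_of_eq_except_last {n : ℕ}
    {M M' : Matrix (Fin (n + 1)) (Fin (n + 1)) ℝ}
    (h : ∀ i j : Fin (n + 1), ¬(i = Fin.last n ∧ j = Fin.last n) → M i j = M' i j)
    (x : Fin (n + 1) → ℝ) :
    M.toQuadraticForm' x - M'.toQuadraticForm' x =
      (M (Fin.last n) (Fin.last n) - M' (Fin.last n) (Fin.last n)) * x (Fin.last n) ^ 2 := by
  have hsub : M - M' = Matrix.single (Fin.last n) (Fin.last n)
      (M (Fin.last n) (Fin.last n) - M' (Fin.last n) (Fin.last n)) := by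
    ext i j
    by_cases hij : i = Fin.last n ∧ j = Fin.last n
    · simp [hij.1, hij.2]
    · rw [Matrix.sub_apply, h i j hij, sub_self, Matrix.single_apply_of_ne]
      exact fun h => hij ⟨h.1.symm, h.2.symm⟩
  rw [toQuadraticForm'_apply_eq_dotProduct, toQuadraticForm'_apply_eq_dotProduct,
    ← dotProduct_sub, ← Matrix.sub_mulVec, hsub, Matrix.single_mulVec]
  change x ⬝ᵥ Pi.single _ _ = _
  rw [dotProduct_single]
  ring

theorem sgn_of_pos {x : ℝ} (hx : 0 < x) : sgn x = 1 := if_pos hx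

theorem sgn_of_neg {x : ℝ} (hx : x < 0) : sgn x = -1 := by
  rw [sgn, if_neg hx.not_gt, if_pos hx]

theorem signature_diff_of_last_entry_le {n : ℕ}
    {M M' : Matrix (Fin (n + 1)) (Fin (n + 1)) ℝ}
    (hM : M.IsSymm) (hM' : M'.IsSymm) (hMdet : M.det ≠ 0) (hM'det : M'.det ≠ 0)
    (h : ∀ i j : Fin (n + 1), ¬(i = Fin.last n ∧ j = Fin.last n) → M i j = M' i j)
    (hle : M' (Fin.last n) (Fin.last n) ≤ M (Fin.last n) (Fin.last n)) :
    signature M - signature M' =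
        sgn (M.submatrix Fin.castSucc Fin.castSucc).det * (sgn M.det - sgn M'.det) ∧
      (signature M - signature M' = 0 ∨ signature M - signature M' = 2) := by
  obtain ⟨hs, hd⟩ := signature_eq_and_sgn_det_eq (Matrix.isHermitian_iff_isSymm.2 hM) hMdet
  obtain ⟨hs', hd'⟩ := signature_eq_and_sgn_det_eq (Matrix.isHermitian_iff_isSymm.2 hM') hM'det
  have hQ := toQuadraticForm'_sub_of_eq_except_last h
  have h1 : sigPos M'.toQuadraticForm' ≤ sigPos M.toQuadraticForm' := sigPos_mono fun x => by
    nlinarith [hQ x, mul_nonneg (sub_nonneg.2 hle) (sq_nonneg (x (Fin.last n)))]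
  have h2 : sigPos M.toQuadraticForm' ≤ sigPos M'.toQuadraticForm' + 1 :=
    sigPos_le_sigPos_add_one (LinearMap.proj (Fin.last n)) fun x hx => by
      have hx' : x (Fin.last n) = 0 := hx
      simpa [hx', sub_eq_zero] using hQ x
  rcases (show sigPos M.toQuadraticForm' = sigPos M'.toQuadraticForm' ∨
    sigPos M.toQuadraticForm' = sigPos M'.toQuadraticForm' + 1 by omega) with he | he
  · rw [hs, hs', hd, hd', he]
    simp
  · have hneg : sgn M.det = -sgn M'.det := by
      rw [hd, hd', he]
      ring
    have hsig : signature M - signature M' = 2 := by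
      rw [hs, hs', he]
      push_cast
      ring
    refine ⟨?_, Or.inr hsig⟩
    rw [hsig]
    have hdet := det_sub_det_of_eq_except_last h
    rcases hMdet.lt_or_gt with hlt | hlt <;> rcases hM'det.lt_or_gt with hlt' | hlt' <;>
      simp only [sgn_of_pos, sgn_of_neg, hlt, hlt'] at hneg ⊢
    · omega
    · rw [sgn_of_neg]
      · norm_num
      · by_contra! hP
        nlinarith [mul_nonneg (sub_nonneg.2 hle) hP]
    · rw [sgn_of_pos]
      · norm_num
      · by_contra! hP
        nlinarith [mul_nonneg (sub_nonneg.2 hle) (neg_nonneg.2 hP)]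
    · omega

/-- let M, M' be nonsingular symmetric n×n real matrices (n ≥ 1, here of
size n+1) that coincide in all entries except possibly the last diagonal entry, and let
P be their common leading principal submatrix. Then
σ(M) − σ(M') = sign(det P)·(sign(det M) − sign(det M')), and in particular
σ(M) − σ(M') ∈ {−2, 0, 2}. -/
theorem signature_diff_of_diagonal_entry_change {n : ℕ}
    (M M' : Matrix (Fin (n + 1)) (Fin (n + 1)) ℝ)
    (hM : M.IsSymm) (hM' : M'.IsSymm)
    (hMdet : M.det ≠ 0) (hM'det : M'.det ≠ 0)
    (hcoincide : ∀ i j : Fin (n + 1), ¬(i = Fin.last n ∧ j = Fin.last n) → M i j = M' i j)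
    (P : Matrix (Fin n) (Fin n) ℝ)
    (hP : P = M.submatrix Fin.castSucc Fin.castSucc) :
    signature M - signature M' = sgn P.det * (sgn M.det - sgn M'.det) ∧
      (signature M - signature M' = -2 ∨ signature M - signature M' = 0 ∨
        signature M - signature M' = 2) := by
  subst hP
  rcases le_total (M' (Fin.last n) (Fin.last n)) (M (Fin.last n) (Fin.last n)) with hle | hle
  · obtain ⟨h1, h2⟩ := signature_diff_of_last_entry_le hM hM' hMdet hM'det hcoincide hle
    exact ⟨h1, Or.inr h2⟩
  · obtain ⟨h1, h2⟩ := signature_diff_of_last_entry_le hM' hM hM'det hMdet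
      (fun i j hij => (hcoincide i j hij).symm) hle
    have hP : M'.submatrix Fin.castSucc Fin.castSucc = M.submatrix Fin.castSucc Fin.castSucc := by
      ext i j
      exact (hcoincide _ _ fun hij => (Fin.castSucc_lt_last i).ne hij.1).symm
    rw [hP] at h1
    exact ⟨by linear_combination -h1, by omega⟩
end

section
/- Let M be an invertible symmetric n×n real matrix, u ∈ ℝⁿ a vector, and c > 0 a real number, and suppose M + c·uuᵀ is invertible. Let k denote the number of positive eigenvalues of M, counted with multiplicity. Then 1 + c·uᵀM⁻¹u ≠ 0, and the number of positive eigenvalues of M + c·uuᵀ, counted with multiplicity, equals k + 1 if 1 + c·uᵀM⁻¹u < 0, and equals k if 1 + c·uᵀM⁻¹u > 0. -/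
open Matrix

/-- The number of positive eigenvalues of a real symmetric (Hermitian) matrix,
counted with multiplicity (junk value 0 if the matrix is not Hermitian). -/
noncomputable def posEigCount {m : Type*} [Fintype m] [DecidableEq m]
    (M : Matrix m m ℝ) : ℕ :=
  if hM : M.IsHermitian then (Finset.univ.filter fun i => 0 < hM.eigenvalues i).card else 0

theorem posEigCount_eq_countP_roots_charpoly {m : Type*} [Fintype m] [DecidableEq m]
    {A : Matrix m m ℝ} (hA : A.IsHermitian) :
    posEigCount A = A.charpoly.roots.countP (0 < ·) := by
  rw [posEigCount, dif_pos hA, hA.roots_charpoly_eq_eigenvalues, Multiset.countP_map]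
  rfl

theorem posEigCount_fromBlocks_zero {m l : Type*} [Fintype m] [DecidableEq m] [Fintype l]
    [DecidableEq l] {A : Matrix m m ℝ} {D : Matrix l l ℝ} (hA : A.IsHermitian)
    (hD : D.IsHermitian) :
    posEigCount (fromBlocks A 0 0 D) = posEigCount A + posEigCount D := by
  rw [posEigCount_eq_countP_roots_charpoly (hA.fromBlocks conjTranspose_zero hD),
    posEigCount_eq_countP_roots_charpoly hA, posEigCount_eq_countP_roots_charpoly hD,
    charpoly_fromBlocks_zero₁₂, Polynomial.roots_mul
      (mul_ne_zero A.charpoly_monic.ne_zero D.charpoly_monic.ne_zero), Multiset.countP_add]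

theorem posEigCount_of_unique {ι : Type*} [Unique ι] [Fintype ι] [DecidableEq ι]
    (A : Matrix ι ι ℝ) :
    posEigCount A = if 0 < A default default then 1 else 0 := by
  have hA : A.IsHermitian := by
    ext i j
    simp [Unique.eq_default i, Unique.eq_default j]
  rw [posEigCount_eq_countP_roots_charpoly hA]
  simp [charpoly, charmatrix, det_unique, ← Multiset.cons_zero, Multiset.countP_cons]

theorem toQuadraticForm'_transpose_mul_mul_equivalent {m : Type*} [Fintype m] [DecidableEq m]
    (A P : Matrix m m ℝ) (hP : IsUnit P.det) :
    (Pᵀ * A * P).toQuadraticForm'.Equivalent A.toQuadraticForm' :=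
  ⟨{ P.toLinearEquiv' (P.invertibleOfIsUnitDet hP) with
      map_app' := fun x => by
        simp [toQuadraticForm', LinearMap.BilinMap.toQuadraticMap_apply, toLinearMap₂'_apply',
          dotProduct_mulVec, vecMul_transpose, ← vecMul_vecMul] }⟩

theorem sigPos_toQuadraticForm' {m : Type*} [Fintype m] [DecidableEq m]
    {A : Matrix m m ℝ} (hA : A.IsHermitian) :
    sigPos A.toQuadraticForm' = posEigCount A := by
  set P : Matrix m m ℝ := (hA.eigenvectorUnitary : Matrix m m ℝ) with hPdef
  have hdet : IsUnit Pᵀ.det := by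
    rw [det_transpose]
    exact (isUnit_iff_isUnit_det _).1 (Unitary.toUnits hA.eigenvectorUnitary).isUnit
  have hdiag : A = Pᵀᵀ * diagonal hA.eigenvalues * Pᵀ := by
    conv_lhs => rw [hA.spectral_theorem, Unitary.conjStarAlgAut_apply]
    rw [transpose_transpose, hPdef, star_eq_conjTranspose, conjTranspose_eq_transpose_of_trivial]
    rfl
  have hsum : (diagonal hA.eigenvalues).toQuadraticForm' =
      QuadraticMap.weightedSumSquares ℝ hA.eigenvalues := by
    ext x
    simp [toQuadraticForm', LinearMap.BilinMap.toQuadraticMap_apply, toLinearMap₂'_apply',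
      dotProduct, mulVec_diagonal, QuadraticMap.weightedSumSquares_apply, mul_left_comm]
  have hequiv := toQuadraticForm'_transpose_mul_mul_equivalent (diagonal hA.eigenvalues) Pᵀ hdet
  rw [← hdiag, hsum] at hequiv
  rw [QuadraticForm.sigPos_of_equiv_weightedSumSquares hequiv, posEigCount, dif_pos hA,
    Set.ncard_eq_toFinset_card']
  simp

theorem posEigCount_transpose_mul_mul {m : Type*} [Fintype m] [DecidableEq m]
    {A : Matrix m m ℝ} (hA : A.IsHermitian) {P : Matrix m m ℝ} (hP : IsUnit P.det) :
    posEigCount (Pᵀ * A * P) = posEigCount A := by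
  have hPA : (Pᵀ * A * P).IsHermitian := by
    simpa using isHermitian_conjTranspose_mul_mul P hA
  rw [← sigPos_toQuadraticForm' hA, ← sigPos_toQuadraticForm' hPA]
  exact (toQuadraticForm'_transpose_mul_mul_equivalent A P hP).sigPos_eq

/-- Additivity of the positive index of inertia under the Schur complement of the upper-left
block. -/
theorem posEigCount_fromBlocks₁₁ {m l : Type*} [Fintype m] [DecidableEq m] [Fintype l]
    [DecidableEq l] {A : Matrix m m ℝ} (B : Matrix m l ℝ) {D : Matrix l l ℝ}
    (hA : A.IsHermitian) (hD : D.IsHermitian) (hAdet : IsUnit A.det) :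
    posEigCount (fromBlocks A B Bᵀ D) = posEigCount A + posEigCount (D - Bᵀ * A⁻¹ * B) := by
  have := A.invertibleOfIsUnitDet hAdet
  have hS : (D - Bᵀ * A⁻¹ * B).IsHermitian :=
    hD.sub (by simpa using isHermitian_conjTranspose_mul_mul B hA.inv)
  have hP : IsUnit (fromBlocks 1 (A⁻¹ * B) 0 1 : Matrix (m ⊕ l) (m ⊕ l) ℝ).det := by simp
  rw [← posEigCount_fromBlocks_zero hA hS,
    ← posEigCount_transpose_mul_mul (hA.fromBlocks conjTranspose_zero hS) hP,
    fromBlocks_eq_of_invertible₁₁, invOf_eq_nonsing_inv, fromBlocks_transpose, transpose_mul,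
    (isHermitian_iff_isSymm.1 hA.inv).eq]
  simp

/-- Additivity of the positive index of inertia under the Schur complement of the lower-right
block. -/
theorem posEigCount_fromBlocks₂₂ {m l : Type*} [Fintype m] [DecidableEq m] [Fintype l]
    [DecidableEq l] {A : Matrix m m ℝ} (B : Matrix m l ℝ) {D : Matrix l l ℝ}
    (hA : A.IsHermitian) (hD : D.IsHermitian) (hDdet : IsUnit D.det) :
    posEigCount (fromBlocks A B Bᵀ D) = posEigCount (A - B * D⁻¹ * Bᵀ) + posEigCount D := by
  have := D.invertibleOfIsUnitDet hDdet
  have hS : (A - B * D⁻¹ * Bᵀ).IsHermitian :=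
    hA.sub (by simpa using isHermitian_mul_mul_conjTranspose B hD.inv)
  have hP : IsUnit (fromBlocks 1 0 (D⁻¹ * Bᵀ) 1 : Matrix (m ⊕ l) (m ⊕ l) ℝ).det := by simp
  rw [← posEigCount_fromBlocks_zero hS hD,
    ← posEigCount_transpose_mul_mul (hS.fromBlocks conjTranspose_zero hD) hP,
    fromBlocks_eq_of_invertible₂₂, invOf_eq_nonsing_inv, fromBlocks_transpose, transpose_mul,
    (isHermitian_iff_isSymm.1 hD.inv).eq]
  simp

/-- let M be an invertible symmetric n×n real matrix, u a vector, c > 0,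
with M + c·uuᵀ invertible, and k the number of positive eigenvalues of M. Then
1 + c·uᵀM⁻¹u ≠ 0, and the number of positive eigenvalues of M + c·uuᵀ equals k + 1
if 1 + c·uᵀM⁻¹u < 0, and equals k if 1 + c·uᵀM⁻¹u > 0. -/
theorem posEigCount_rank_one_update {n : ℕ}
    (M : Matrix (Fin n) (Fin n) ℝ) (hM : M.IsSymm) (hMdet : IsUnit M.det)
    (u : Fin n → ℝ) (c : ℝ) (hc : 0 < c)
    (hM'det : IsUnit (M + c • vecMulVec u u).det) :
    1 + c * (u ⬝ᵥ (M⁻¹ *ᵥ u)) ≠ 0 ∧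
      (1 + c * (u ⬝ᵥ (M⁻¹ *ᵥ u)) < 0 →
        posEigCount (M + c • vecMulVec u u) = posEigCount M + 1) ∧
      (0 < 1 + c * (u ⬝ᵥ (M⁻¹ *ᵥ u)) →
        posEigCount (M + c • vecMulVec u u) = posEigCount M) := by
  have hMh : M.IsHermitian := isHermitian_iff_isSymm.2 hM
  have hquad : replicateRow Unit u * M⁻¹ * replicateCol Unit u =
      diagonal fun _ => u ⬝ᵥ (M⁻¹ *ᵥ u) := by
    ext i j
    rw [Matrix.mul_assoc, ← replicateCol_mulVec, replicateRow_mul_replicateCol_apply]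
    simp
  set q := u ⬝ᵥ (M⁻¹ *ᵥ u)
  have hrank : c • vecMulVec u u = (c • replicateCol Unit u) * replicateRow Unit u := by
    rw [smul_mul, ← vecMulVec_eq]
  have hne : 1 + c * q ≠ 0 := by
    rw [hrank, det_add_mul _ _ hMdet, Matrix.mul_smul, hquad, IsUnit.mul_iff] at hM'det
    simpa [det_unique] using hM'det.2
  let D : Matrix Unit Unit ℝ := diagonal fun _ => -c⁻¹
  have hDh : D.IsHermitian := isHermitian_diagonal _
  have hDdet : IsUnit D.det := by simp [D, hc.ne']
  have hDinv : D⁻¹ = diagonal fun _ => -c := by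
    refine inv_eq_right_inv ?_
    simp [D, hc.ne']
  have hupdate : M - replicateCol Unit u * D⁻¹ * (replicateCol Unit u)ᵀ =
      M + c • vecMulVec u u := by
    ext i j
    simp [hDinv, mul_apply, vecMulVec_apply]
    ring
  have hcount := (posEigCount_fromBlocks₂₂ (replicateCol Unit u) hMh hDh hDdet).symm.trans
    (posEigCount_fromBlocks₁₁ (replicateCol Unit u) hMh hDh hMdet)
  rw [hupdate, transpose_replicateCol, hquad, posEigCount_of_unique D,
    posEigCount_of_unique (D - _), if_neg (by simp [D, hc.le])] at hcount
  have hsign : -c⁻¹ - q = -(1 + c * q) / c := by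
    field_simp
    ring
  simp only [D, Matrix.sub_apply, diagonal_apply_eq, hsign, add_zero] at hcount
  refine ⟨hne, fun h => ?_, fun h => ?_⟩
  · rwa [if_pos (div_pos (neg_pos.2 h) hc)] at hcount
  · rwa [if_neg (div_neg_of_neg_of_pos (neg_neg_of_pos h) hc).not_gt] at hcount
end

section
/- Let M be a nonsingular symmetric n×n real matrix and let N be a nonsingular symmetric (n+1)×(n+1) real matrix whose leading principal n×n submatrix (obtained by deleting the last row and column of N) equals M, and suppose det(N) = 2·det(M). Then σ(N) = σ(M) + 1. -/
open Matrix

open QuadraticMap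

namespace Matrix

variable {m k : Type*} [Fintype m] [DecidableEq m] [Fintype k] [DecidableEq k]

/-- Congruent matrices define equivalent quadratic forms. -/
lemma toQuadraticForm'_equivalent_of_congr {A : Matrix m m ℝ} {B : Matrix k k ℝ}
    {P : Matrix m k ℝ} {R : Matrix k m ℝ} (hPR : P * R = 1) (hRP : R * P = 1)
    (h : Pᵀ * A * P = B) : Equivalent A.toQuadraticForm' B.toQuadraticForm' := by
  refine Equivalent.symm ⟨⟨toLin'OfInv hRP hPR, fun x ↦ ?_⟩⟩
  change toLinearMap₂' ℝ A (P *ᵥ x) (P *ᵥ x) = toLinearMap₂' ℝ B x x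
  rw [toLinearMap₂'_apply', toLinearMap₂'_apply', ← h, ← mulVec_mulVec, ← mulVec_mulVec,
    dotProduct_mulVec x, vecMul_transpose]

lemma toQuadraticForm'_diagonal (w : m → ℝ) :
    (diagonal w).toQuadraticForm' = weightedSumSquares ℝ w := by
  ext x
  change toLinearMap₂' ℝ (diagonal w) x x = _
  simp only [toLinearMap₂'_apply', weightedSumSquares_apply, dotProduct, mulVec_diagonal,
    smul_eq_mul]
  exact Finset.sum_congr rfl fun i _ ↦ by ring

lemma IsHermitian.eigenvectorUnitary_transpose_mul_mul {A : Matrix m m ℝ} (hA : A.IsHermitian) :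
    (hA.eigenvectorUnitary : Matrix m m ℝ)ᵀ * A * (hA.eigenvectorUnitary : Matrix m m ℝ) =
      diagonal hA.eigenvalues := by
  have h := hA.conjStarAlgAut_star_eigenvectorUnitary
  rw [Unitary.conjStarAlgAut_star_apply] at h
  exact h

lemma IsHermitian.eigenvectorUnitary_mul_transpose {A : Matrix m m ℝ} (hA : A.IsHermitian) :
    (hA.eigenvectorUnitary : Matrix m m ℝ) * (hA.eigenvectorUnitary : Matrix m m ℝ)ᵀ = 1 :=
  Unitary.coe_mul_star_self hA.eigenvectorUnitary

lemma IsHermitian.eigenvectorUnitary_transpose_mul {A : Matrix m m ℝ} (hA : A.IsHermitian) :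
    (hA.eigenvectorUnitary : Matrix m m ℝ)ᵀ * (hA.eigenvectorUnitary : Matrix m m ℝ) = 1 :=
  Unitary.coe_star_mul_self hA.eigenvectorUnitary

/-- The signature of a symmetric matrix can be read off from any diagonalization of its
quadratic form (Sylvester's law of inertia). -/
lemma IsHermitian.signature_eq_of_equivalent {ι : Type*} [Fintype ι] {A : Matrix m m ℝ}
    (hA : A.IsHermitian) {w : ι → ℝ}
    (h : Equivalent A.toQuadraticForm' (weightedSumSquares ℝ w)) :
    signature A = ((Finset.univ.filter fun i ↦ 0 < w i).card : ℤ) -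
      ((Finset.univ.filter fun i ↦ w i < 0).card : ℤ) := by
  have hd : Equivalent A.toQuadraticForm' (weightedSumSquares ℝ hA.eigenvalues) := by
    rw [← toQuadraticForm'_diagonal]
    exact toQuadraticForm'_equivalent_of_congr hA.eigenvectorUnitary_mul_transpose
      hA.eigenvectorUnitary_transpose_mul hA.eigenvectorUnitary_transpose_mul_mul
  have hp := hd.sigPos_eq.symm.trans h.sigPos_eq
  have hn := hd.sigNeg_eq.symm.trans h.sigNeg_eq
  simp only [QuadraticForm.sigPos_weightedSumSquares, QuadraticForm.sigNeg_weightedSumSquares,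
    Set.ncard_eq_toFinset_card', Set.toFinset_ofPred] at hp hn
  rw [signature, dif_pos hA, hp, hn]

/-- Completing the square: a symmetric block matrix with invertible upper left block is congruent
to the block diagonal matrix formed by that block and its Schur complement. -/
lemma toQuadraticForm'_fromBlocks_equivalent {A : Matrix m m ℝ} (hA : A.IsSymm)
    (hdet : IsUnit A.det) (B : Matrix m k ℝ) (D : Matrix k k ℝ) :
    Equivalent (fromBlocks A B Bᵀ D).toQuadraticForm'
      (fromBlocks A 0 0 (D - Bᵀ * A⁻¹ * B)).toQuadraticForm' := by
  have hA' : (A⁻¹)ᵀ = A⁻¹ := by rw [transpose_nonsing_inv, hA.eq]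
  refine toQuadraticForm'_equivalent_of_congr (P := fromBlocks 1 (-(A⁻¹ * B)) 0 1)
    (R := fromBlocks 1 (A⁻¹ * B) 0 1) ?_ ?_ ?_
  · simp [fromBlocks_multiply]
  · simp [fromBlocks_multiply]
  · simp [fromBlocks_multiply, fromBlocks_transpose, hA', Matrix.mul_assoc,
      mul_nonsing_inv_cancel_left _ _ hdet, nonsing_inv_mul _ hdet, sub_eq_neg_add]

end Matrix

/-- if M is a nonsingular symmetric n×n real matrix and N is a nonsingular
symmetric (n+1)×(n+1) real matrix whose leading principal n×n submatrix is M, and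
det(N) = 2·det(M), then σ(N) = σ(M) + 1. -/
theorem signature_succ_of_det_eq_two_mul {n : ℕ}
    (M : Matrix (Fin n) (Fin n) ℝ) (hM : M.IsSymm) (hMdet : M.det ≠ 0)
    (N : Matrix (Fin (n + 1)) (Fin (n + 1)) ℝ) (hN : N.IsSymm) (hNdet : N.det ≠ 0)
    (hsub : N.submatrix Fin.castSucc Fin.castSucc = M)
    (hdet : N.det = 2 * M.det) :
    signature N = signature M + 1 := by
  have hMu : IsUnit M.det := hMdet.isUnit
  have hMh : M.IsHermitian := isHermitian_iff_isSymm.mpr hM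
  have hNh : N.IsHermitian := isHermitian_iff_isSymm.mpr hN
  let e : Fin n ⊕ Fin 1 ≃ Fin (n + 1) := finSumFinEquiv
  set B : Matrix (Fin n) (Fin 1) ℝ := (N.submatrix e e).toBlocks₁₂
  set D : Matrix (Fin 1) (Fin 1) ℝ := (N.submatrix e e).toBlocks₂₂
  have hblocks : N.submatrix e e = fromBlocks M B Bᵀ D := by
    have h₁₁ : (N.submatrix e e).toBlocks₁₁ = M := hsub
    have h₂₁ : (N.submatrix e e).toBlocks₂₁ = Bᵀ := by
      ext i j
      exact hN.apply _ _
    rw [← h₁₁, ← h₂₁, fromBlocks_toBlocks]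
  have hschur : D - Bᵀ * M⁻¹ * B = diagonal fun _ ↦ 2 := by
    have hinv : Invertible M := invertibleOfIsUnitDet M hMu
    have h : M.det * (D - Bᵀ * M⁻¹ * B).det = 2 * M.det := by
      rw [← hdet, ← det_submatrix_equiv_self e N, hblocks, det_fromBlocks₁₁, invOf_eq_nonsing_inv]
    rw [mul_comm, mul_left_inj' hMdet, det_fin_one] at h
    ext i j
    rw [Subsingleton.elim i 0, Subsingleton.elim j 0, h, diagonal_apply_eq]
  have hreindex : Equivalent N.toQuadraticForm' (N.submatrix e e).toQuadraticForm' := by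
    refine toQuadraticForm'_equivalent_of_congr (P := (1 : Matrix _ _ ℝ).submatrix id e)
      (R := (1 : Matrix _ _ ℝ).submatrix e id) ?_ ?_ ?_
    · rw [submatrix_mul_equiv]; simp
    · rw [← submatrix_mul _ _ _ _ _ Function.bijective_id]; simp
    · ext i j
      simp [mul_apply, one_apply]
  have hdiag : Equivalent (fromBlocks M 0 0 (D - Bᵀ * M⁻¹ * B)).toQuadraticForm'
      (weightedSumSquares ℝ (Sum.elim hMh.eigenvalues fun _ : Fin 1 ↦ 2)) := by
    rw [← toQuadraticForm'_diagonal, hschur]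
    refine toQuadraticForm'_equivalent_of_congr
      (P := fromBlocks (hMh.eigenvectorUnitary : Matrix _ _ ℝ) 0 0 1)
      (R := fromBlocks (hMh.eigenvectorUnitary : Matrix _ _ ℝ)ᵀ 0 0 1) ?_ ?_ ?_
    · simp [fromBlocks_multiply, hMh.eigenvectorUnitary_mul_transpose]
    · simp [fromBlocks_multiply, hMh.eigenvectorUnitary_transpose_mul]
    · simp only [fromBlocks_transpose, fromBlocks_multiply, transpose_zero, transpose_one,
        Matrix.mul_zero, Matrix.zero_mul, add_zero, zero_add, Matrix.one_mul, Matrix.mul_one,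
        hMh.eigenvectorUnitary_transpose_mul_mul, fromBlocks_diagonal]
  have hequiv := (hreindex.trans (hblocks ▸ toQuadraticForm'_fromBlocks_equivalent hM hMu B D)).trans
    hdiag
  rw [hNh.signature_eq_of_equivalent hequiv, signature, dif_pos hMh]
  simp only [Finset.card_filter, Fintype.sum_sum_type, Sum.elim_inl, Sum.elim_inr,
    Fintype.sum_unique, zero_lt_two, not_lt_of_gt zero_lt_two, if_true, if_false]
  rw [add_zero, Nat.cast_add, Nat.cast_one, add_sub_right_comm]
  rfl
end

section
/- (Weyl's inequality.) Let A and B be n×n Hermitian complex matrices, and for a Hermitian matrix H let λ₁(H) ≤ λ₂(H) ≤ ⋯ ≤ λₙ(H) denote its (real) eigenvalues arranged in nondecreasing order with multiplicity. Then for each i with 1 ≤ i ≤ n: (1) λᵢ(A+B) ≤ λ_{i+j}(A) + λ_{n−j}(B) for every j = 0, 1, …, n−i, and (2) λ_{i−j+1}(A) + λⱼ(B) ≤ λᵢ(A+B) for every j = 1, …, i. -/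
open Matrix

/-- The eigenvalues of a Hermitian complex matrix arranged in nondecreasing order, with
multiplicity (junk value 0 if the matrix is not Hermitian). -/
noncomputable def sortedEigsC {n : ℕ} (M : Matrix (Fin n) (Fin n) ℂ) : Fin n → ℝ :=
  if hM : M.IsHermitian then hM.eigenvalues ∘ Tuple.sort hM.eigenvalues else 0

section Weyl

variable {𝕜 E ι : Type*} [RCLike 𝕜] [NormedAddCommGroup E] [InnerProductSpace 𝕜 E]

/-- Fewer vectors than the dimension have a common nonzero orthogonal vector. -/
lemma exists_ne_zero_forall_mem_inner_eq_zero [FiniteDimensional 𝕜 E] (s : Finset E)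
    (hs : s.card < Module.finrank 𝕜 E) : ∃ x : E, x ≠ 0 ∧ ∀ v ∈ s, inner 𝕜 v x = 0 := by
  have hspan := (finrank_span_finset_le_card (R := 𝕜) s).trans_lt hs
  have hne : (Submodule.span 𝕜 (s : Set E))ᗮ ≠ ⊥ := by
    intro h
    have hsum := (Submodule.span 𝕜 (s : Set E)).finrank_add_finrank_orthogonal
    rw [h, finrank_bot] at hsum
    exact hspan.ne hsum
  obtain ⟨x, hx, hx0⟩ := Submodule.exists_mem_ne_zero_of_ne_bot hne
  exact ⟨x, hx0, fun v hv ↦ hx v (Submodule.subset_span hv)⟩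

/-- The quadratic form of a symmetric operator in an orthonormal basis of eigenvectors. -/
lemma LinearMap.IsSymmetric.re_inner_eq_sum [Fintype ι] {T : E →ₗ[𝕜] E} (hT : T.IsSymmetric)
    (b : OrthonormalBasis ι 𝕜 E) {μ : ι → ℝ} (hb : ∀ k, T (b k) = (μ k : 𝕜) • b k) (x : E) :
    RCLike.re (inner 𝕜 x (T x)) = ∑ k, μ k * ‖inner 𝕜 (b k) x‖ ^ 2 := by
  rw [← b.sum_inner_mul_inner x (T x), map_sum]
  refine Finset.sum_congr rfl fun k _ ↦ ?_
  rw [← hT, hb, inner_smul_left, RCLike.conj_ofReal, mul_left_comm, ← inner_conj_symm x (b k),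
    RCLike.conj_mul, RCLike.re_ofReal_mul]
  norm_cast

/-- On vectors orthogonal to the eigenvectors with large eigenvalues, the quadratic form is
bounded above. -/
lemma LinearMap.IsSymmetric.re_inner_le [Fintype ι] {T : E →ₗ[𝕜] E} (hT : T.IsSymmetric)
    (b : OrthonormalBasis ι 𝕜 E) {μ : ι → ℝ} (hb : ∀ k, T (b k) = (μ k : 𝕜) • b k) {x : E}
    {c : ℝ} (hx : ∀ k, inner 𝕜 (b k) x = 0 ∨ μ k ≤ c) :
    RCLike.re (inner 𝕜 x (T x)) ≤ c * ‖x‖ ^ 2 := by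
  rw [hT.re_inner_eq_sum b hb, ← b.sum_sq_norm_inner_right, Finset.mul_sum]
  refine Finset.sum_le_sum fun k _ ↦ ?_
  obtain h | h := hx k
  · simp [h]
  · gcongr

/-- On vectors orthogonal to the eigenvectors with small eigenvalues, the quadratic form is
bounded below. -/
lemma LinearMap.IsSymmetric.le_re_inner [Fintype ι] {T : E →ₗ[𝕜] E} (hT : T.IsSymmetric)
    (b : OrthonormalBasis ι 𝕜 E) {μ : ι → ℝ} (hb : ∀ k, T (b k) = (μ k : 𝕜) • b k) {x : E}
    {c : ℝ} (hx : ∀ k, inner 𝕜 (b k) x = 0 ∨ c ≤ μ k) :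
    c * ‖x‖ ^ 2 ≤ RCLike.re (inner 𝕜 x (T x)) := by
  rw [hT.re_inner_eq_sum b hb, ← b.sum_sq_norm_inner_right, Finset.mul_sum]
  refine Finset.sum_le_sum fun k _ ↦ ?_
  obtain h | h := hx k
  · simp [h]
  · gcongr

end Weyl

lemma sortedEigsC_monotone {n : ℕ} {M : Matrix (Fin n) (Fin n) ℂ} (hM : M.IsHermitian) :
    Monotone (sortedEigsC M) := by
  rw [sortedEigsC, dif_pos hM]
  exact Tuple.monotone_sort _

lemma exists_orthonormalBasis_sortedEigsC {n : ℕ} {M : Matrix (Fin n) (Fin n) ℂ}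
    (hM : M.IsHermitian) : ∃ b : OrthonormalBasis (Fin n) ℂ (EuclideanSpace ℂ (Fin n)),
      ∀ k, toEuclideanLin M (b k) = (sortedEigsC M k : ℂ) • b k := by
  refine ⟨hM.eigenvectorBasis.reindex (Tuple.sort hM.eigenvalues).symm, fun k ↦ ?_⟩
  ext l
  simpa [sortedEigsC, dif_pos hM, toLpLin_apply] using
    congrFun (hM.mulVec_eigenvectorBasis (Tuple.sort hM.eigenvalues k)) l

/-- Three orthonormal bases: a nonzero vector orthogonal to prescribed members of each, provided
that fewer than `n` members are prescribed in total. -/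
lemma exists_ne_zero_inner_basis_eq_zero {n : ℕ}
    (a b c : OrthonormalBasis (Fin n) ℂ (EuclideanSpace ℂ (Fin n))) (r s t : Finset (Fin n))
    (h : r.card + s.card + t.card < n) : ∃ x : EuclideanSpace ℂ (Fin n), x ≠ 0 ∧
      (∀ k ∈ r, inner ℂ (a k) x = 0) ∧ (∀ k ∈ s, inner ℂ (b k) x = 0) ∧
        ∀ k ∈ t, inner ℂ (c k) x = 0 := by
  classical
  obtain ⟨x, hx0, hx⟩ := exists_ne_zero_forall_mem_inner_eq_zero (𝕜 := ℂ)
    (r.image a ∪ s.image b ∪ t.image c) (by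
      rw [finrank_euclideanSpace_fin]
      refine lt_of_le_of_lt ((Finset.card_union_le _ _).trans ?_) h
      exact add_le_add ((Finset.card_union_le _ _).trans
        (add_le_add Finset.card_image_le Finset.card_image_le)) Finset.card_image_le)
  simp only [Finset.mem_union, Finset.mem_image] at hx
  exact ⟨x, hx0, fun k hk ↦ hx _ (.inl (.inl ⟨k, hk, rfl⟩)),
    fun k hk ↦ hx _ (.inl (.inr ⟨k, hk, rfl⟩)), fun k hk ↦ hx _ (.inr ⟨k, hk, rfl⟩)⟩

/-- Weyl's inequality: for n×n Hermitian complex matrices A, B, with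
λ₁(H) ≤ ⋯ ≤ λₙ(H) the eigenvalues of a Hermitian matrix H in nondecreasing order, for
each 1 ≤ i ≤ n:
(1) λᵢ(A+B) ≤ λ_{i+j}(A) + λ_{n−j}(B) for every j = 0, 1, …, n−i, and
(2) λ_{i−j+1}(A) + λⱼ(B) ≤ λᵢ(A+B) for every j = 1, …, i.
(Here indices are written 0-based via `Fin n`: the 1-based index i corresponds to the
0-based index i−1.) -/
theorem weyl_inequality {n : ℕ} (A B : Matrix (Fin n) (Fin n) ℂ)
    (hA : A.IsHermitian) (hB : B.IsHermitian) :
    (∀ i : Fin n, ∀ j : ℕ, (h : (i : ℕ) + j < n) →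
      sortedEigsC (A + B) i ≤
        sortedEigsC A ⟨(i : ℕ) + j, h⟩ + sortedEigsC B ⟨n - 1 - j, by omega⟩) ∧
      (∀ i j : Fin n, (j : ℕ) ≤ (i : ℕ) →
        sortedEigsC A ⟨(i : ℕ) - (j : ℕ), by omega⟩ + sortedEigsC B j ≤
          sortedEigsC (A + B) i) := by
  have hC := hA.add hB
  have mA := sortedEigsC_monotone hA
  have mB := sortedEigsC_monotone hB
  have mC := sortedEigsC_monotone hC
  obtain ⟨a, ha⟩ := exists_orthonormalBasis_sortedEigsC hA
  obtain ⟨b, hb⟩ := exists_orthonormalBasis_sortedEigsC hB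
  obtain ⟨c, hc⟩ := exists_orthonormalBasis_sortedEigsC hC
  have sA := isSymmetric_toEuclideanLin_iff.mpr hA
  have sB := isSymmetric_toEuclideanLin_iff.mpr hB
  have sC := isSymmetric_toEuclideanLin_iff.mpr hC
  have hadd (x : EuclideanSpace ℂ (Fin n)) :
      RCLike.re (inner ℂ x (toEuclideanLin (A + B) x)) =
        RCLike.re (inner ℂ x (toEuclideanLin A x)) +
          RCLike.re (inner ℂ x (toEuclideanLin B x)) := by
    rw [map_add, LinearMap.add_apply, inner_add_right, map_add]
  refine ⟨fun i j h ↦ ?_, fun i j h ↦ ?_⟩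
  · obtain ⟨x, hx0, hxa, hxb, hxc⟩ := exists_ne_zero_inner_basis_eq_zero a b c
      (Finset.Ioi ⟨(i : ℕ) + j, h⟩) (Finset.Ioi ⟨n - 1 - j, by omega⟩) (Finset.Iio i)
      (by simp only [Fin.card_Ioi, Fin.card_Iio]; omega)
    have qa := sA.re_inner_le a ha fun k ↦
      (lt_or_ge _ k).imp (fun hk ↦ hxa k (Finset.mem_Ioi.mpr hk)) fun hk ↦ mA hk
    have qb := sB.re_inner_le b hb fun k ↦
      (lt_or_ge _ k).imp (fun hk ↦ hxb k (Finset.mem_Ioi.mpr hk)) fun hk ↦ mB hk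
    have qc := sC.le_re_inner c hc fun k ↦
      (lt_or_ge k _).imp (fun hk ↦ hxc k (Finset.mem_Iio.mpr hk)) fun hk ↦ mC hk
    refine le_of_mul_le_mul_right ?_ (pow_pos (norm_pos_iff.mpr hx0) 2)
    linarith [hadd x]
  · obtain ⟨x, hx0, hxa, hxb, hxc⟩ := exists_ne_zero_inner_basis_eq_zero a b c
      (Finset.Iio ⟨(i : ℕ) - (j : ℕ), by omega⟩) (Finset.Iio j) (Finset.Ioi i)
      (by simp only [Fin.card_Ioi, Fin.card_Iio]; omega)
    have qa := sA.le_re_inner a ha fun k ↦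
      (lt_or_ge k _).imp (fun hk ↦ hxa k (Finset.mem_Iio.mpr hk)) fun hk ↦ mA hk
    have qb := sB.le_re_inner b hb fun k ↦
      (lt_or_ge k _).imp (fun hk ↦ hxb k (Finset.mem_Iio.mpr hk)) fun hk ↦ mB hk
    have qc := sC.re_inner_le c hc fun k ↦
      (lt_or_ge _ k).imp (fun hk ↦ hxc k (Finset.mem_Ioi.mpr hk)) fun hk ↦ mC hk
    refine le_of_mul_le_mul_right ?_ (pow_pos (norm_pos_iff.mpr hx0) 2)
    linarith [hadd x]
end
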